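/- Let D ⊂ Ĉ be a closed Jordan region in the Riemann sphere (homeomorphic to the closed unit disk). Then either diam(D) = diam(∂D), or diam(D) = 2 and diam(Ĉ \ int(D)) = diam(∂D), where diameters are taken with respect to the chordal metric. -/

import Mathlib

open Metric

section ContinuousLog

variable {X : Type*} [TopologicalSpace X]

/-- Every nonvanishing continuous complex function on `S` has a continuous logarithm on `S`. -/
def HasContinuousLogOn (S : Set X) : Prop :=
  ∀ f : X → ℂ, ContinuousOn f S → (∀ x ∈ S, f x ≠ 0) →
    ∃ g : X → ℂ, ContinuousOn g S ∧ ∀ x ∈ S, Complex.exp (g x) = f x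

lemma Complex.exists_continuous_log {f : ℂ → ℂ} (hf : Continuous f) (h0 : ∀ z, f z ≠ 0) :
    ∃ g : ℂ → ℂ, Continuous g ∧ ∀ z, Complex.exp (g z) = f z := by
  obtain ⟨g, ⟨-, hg⟩, -⟩ := Complex.isCoveringMapOn_exp.existsUnique_continuousMap_lifts
    (⟨f, hf⟩ : C(ℂ, ℂ)) (a₀ := 0) (Complex.exp_log (h0 0)) h0
  exact ⟨g, g.continuous, fun z ↦ congrFun hg z⟩

/-- Retracts of the plane admit continuous logarithms. -/
lemma HasContinuousLogOn.of_retract {S : Set X} (i : C(S, ℂ)) (r : C(ℂ, S))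
    (hr : ∀ x, r (i x) = x) : HasContinuousLogOn S := by
  classical
  intro f hf h0
  have hf' : Continuous fun z ↦ f (r z) :=
    hf.comp_continuous (continuous_subtype_val.comp r.continuous) fun z ↦ (r z).2
  obtain ⟨k, hk, hkf⟩ := Complex.exists_continuous_log hf' fun z ↦ h0 _ (r z).2
  refine ⟨fun x ↦ if h : x ∈ S then k (i ⟨x, h⟩) else 0, ?_, fun x hx ↦ ?_⟩
  · rw [continuousOn_iff_continuous_domRestrict]
    convert! hk.comp i.continuous
    ext x
    simp
  · simp [hx, hkf, hr]

/-- Two continuous logarithms of the same function differ by a constant on a preconnected set. -/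
lemma sub_eq_sub_of_exp_eq {S : Set X} (hS : IsPreconnected S) {f g : X → ℂ}
    (hf : ContinuousOn f S) (hg : ContinuousOn g S)
    (h : ∀ x ∈ S, Complex.exp (f x) = Complex.exp (g x)) {x y : X} (hx : x ∈ S) (hy : y ∈ S) :
    f x - g x = f y - g y := by
  have key := Complex.isCoveringMap_exp.eqOn_of_comp_eqOn hS (g₁ := f)
    (g₂ := fun z ↦ g z + (f x - g x)) hf (by fun_prop) (fun z hz ↦ by
      simp [Complex.exp_add, Complex.exp_sub, h z hz, h x hx]) hx (by simp) hy
  simp only at key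
  rw [key]; ring

lemma HasContinuousLogOn.union {U V : Set X} (hU : IsOpen U) (hV : IsOpen V)
    (hUV : IsConnected (U ∩ V)) (hlU : HasContinuousLogOn U) (hlV : HasContinuousLogOn V) :
    HasContinuousLogOn (U ∪ V) := by
  classical
  intro f hf h0
  obtain ⟨g, hg, hgf⟩ := hlU f (hf.mono Set.subset_union_left) fun x hx ↦ h0 x (.inl hx)
  obtain ⟨k, hk, hkf⟩ := hlV f (hf.mono Set.subset_union_right) fun x hx ↦ h0 x (.inr hx)
  obtain ⟨a, ha⟩ := hUV.nonempty
  have hc : ∀ x ∈ U ∩ V, g x = k x + (g a - k a) := fun x hx ↦ by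
    rw [← sub_eq_sub_of_exp_eq hUV.isPreconnected (hg.mono Set.inter_subset_left)
      (hk.mono Set.inter_subset_right) (fun x hx ↦ by rw [hgf x hx.1, hkf x hx.2]) hx ha]
    ring
  have hexp : Complex.exp (g a - k a) = 1 := by
    rw [Complex.exp_sub, hgf a ha.1, hkf a ha.2, div_self (h0 a (.inl ha.1))]
  refine ⟨U.piecewise g fun x ↦ k x + (g a - k a), ?_, ?_⟩
  · refine ContinuousOn.union_of_isOpen (hg.congr fun x hx ↦ by simp [hx]) ?_ hU hV
    refine ContinuousOn.congr (f := fun x ↦ k x + (g a - k a)) (by fun_prop) fun x hx ↦ ?_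
    by_cases hxU : x ∈ U
    · simp [hxU, hc x ⟨hxU, hx⟩]
    · simp [hxU]
  · intro x hx
    by_cases hxU : x ∈ U
    · simp [hxU, hgf]
    · simp [hxU, Complex.exp_add, hexp, hkf x (hx.resolve_left hxU)]

/-- A normal space with continuous logarithms is unicoherent. -/
lemma IsPreconnected.inter_of_union_eq_univ [NormalSpace X]
    (hX : HasContinuousLogOn (Set.univ : Set X)) {A B : Set X} (hA : IsClosed A) (hB : IsClosed B)
    (hAc : IsPreconnected A) (hBc : IsPreconnected B) (hAB : A ∪ B = Set.univ) :
    IsPreconnected (A ∩ B) := by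
  classical
  rw [isPreconnected_iff_subset_of_disjoint_closed]
  intro u v hu hv huv hd
  by_contra! hcon
  obtain ⟨⟨y, hy, hyu⟩, ⟨x, hx, hxv⟩⟩ := hcon.imp Set.not_subset.1 Set.not_subset.1
  have hxu := (huv hx).resolve_right hxv
  have hyv := (huv hy).resolve_left hyu
  obtain ⟨φ, hφu, hφv, -⟩ := exists_continuous_zero_one_of_isClosed
    ((hA.inter hB).inter hu) ((hA.inter hB).inter hv) (by
      rw [Set.disjoint_iff_inter_eq_empty, ← hd]; ext; simp; tauto)
  have hφ : ∀ z ∈ A ∩ B, Complex.exp (2 * Real.pi * Complex.I * φ z) = 1 := fun z hz ↦ by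
    rcases huv hz with h | h
    · simp [hφu ⟨hz, h⟩]
    · simp [hφv ⟨hz, h⟩, Complex.exp_two_pi_mul_I]
  have hfr : frontier A ⊆ A ∩ B := fun z hz ↦ by
    refine ⟨hA.frontier_subset hz, hB.closure_subset_iff.2 ?_
      (frontier_subset_closure (s := Aᶜ) (by rwa [frontier_compl]))⟩
    intro w hw
    exact ((hAB ▸ Set.mem_univ w : w ∈ A ∪ B)).resolve_left hw
  have hφc : Continuous fun z ↦ 2 * Real.pi * Complex.I * (φ z : ℂ) := by fun_prop
  obtain ⟨g, hg, hgf⟩ := hX (A.piecewise (fun z ↦ Complex.exp (2 * Real.pi * Complex.I * φ z)) 1)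
    (Continuous.piecewise (fun z hz ↦ hφ z (hfr hz)) (by fun_prop) continuous_one).continuousOn
    (fun z _ ↦ by by_cases hz : z ∈ A <;> simp [hz])
  have h1 := sub_eq_sub_of_exp_eq hAc (hg.mono (Set.subset_univ _)) hφc.continuousOn
    (fun z hz ↦ by rw [hgf z trivial]; simp [hz]) hx.1 hy.1
  have h2 := sub_eq_sub_of_exp_eq hBc (hg.mono (Set.subset_univ _)) (continuousOn_const (c := 0))
    (fun z hz ↦ by
      rw [hgf z trivial]
      by_cases hzA : z ∈ A
      · simp [hzA, hφ z ⟨hzA, hz⟩]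
      · simp [hzA]) hx.2 hy.2
  rw [hφu ⟨hx, hxu⟩, hφv ⟨hy, hyv⟩, sub_zero, sub_zero] at *
  simp only [h2, Pi.zero_apply, Pi.one_apply, Complex.ofReal_zero, Complex.ofReal_one] at h1
  exact Complex.two_pi_I_ne_zero (by linear_combination h1)

/-- There is no continuous logarithm of `z - z₀` on a circle around `z₀`. -/
lemma not_exists_continuous_log_sub {z₀ : ℂ} {R : ℝ} (hR : 0 < R) {g : ℂ → ℂ} (hg : Continuous g)
    (h : ∀ z ∈ sphere z₀ R, Complex.exp (g z) = z - z₀) : False := by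
  have h1 := sub_eq_sub_of_exp_eq (X := ℝ) isPreconnected_univ
    (f := fun t ↦ g (z₀ + R * Complex.exp (t * Complex.I)))
    (g := fun t ↦ Real.log R + t * Complex.I) (by fun_prop) (by fun_prop) (fun t _ ↦ by
      rw [h _ (by simp [Complex.norm_exp_ofReal_mul_I, abs_of_pos hR]), Complex.exp_add,
        ← Complex.ofReal_exp, Real.exp_log hR]
      ring) (Set.mem_univ 0) (Set.mem_univ (2 * Real.pi))
  simp [Complex.exp_two_pi_mul_I] at h1

/-- A closed plane set with continuous logarithms does not bound any nonempty bounded set. -/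
lemma HasContinuousLogOn.eq_empty_of_frontier_subset {K W : Set ℂ} (hK : IsClosed K)
    (hlK : HasContinuousLogOn K) (hWb : Bornology.IsBounded W)
    (hWK : Disjoint W K) (hfr : frontier W ⊆ K) : W = ∅ := by
  classical
  by_contra hne
  obtain ⟨z₀, hz₀⟩ := Set.nonempty_iff_ne_empty.2 hne
  obtain ⟨k, hk, hkf⟩ := hlK (fun z ↦ z - z₀) (by fun_prop) fun z hz h ↦
    hWK.le_bot ⟨hz₀, (sub_eq_zero.1 h) ▸ hz⟩
  obtain ⟨G, hG⟩ := ContinuousMap.exists_restrict_eq hK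
    ⟨K.domRestrict k, continuousOn_iff_continuous_domRestrict.1 hk⟩
  have hGk : ∀ z ∈ K, G z = k z := fun z hz ↦ DFunLike.congr_fun hG ⟨z, hz⟩
  obtain ⟨g, hg, hgf⟩ := Complex.exists_continuous_log
    (f := W.piecewise (fun z ↦ Complex.exp (G z)) fun z ↦ z - z₀)
    (Continuous.piecewise (fun z hz ↦ by rw [hGk z (hfr hz), hkf z (hfr hz)])
      (by fun_prop) (by fun_prop))
    (fun z ↦ by
      by_cases hz : z ∈ W
      · simp [hz]
      · simpa [hz, sub_eq_zero] using fun h ↦ hz (by rwa [h]))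
  obtain ⟨R, hR, hWR⟩ := hWb.subset_ball_lt 0 z₀
  refine not_exists_continuous_log_sub (z₀ := z₀) hR hg fun z hz ↦ ?_
  have : z ∉ W := fun h ↦ (mem_ball.1 (hWR h)).ne (mem_sphere.1 hz)
  rw [hgf, Set.piecewise_eq_of_notMem _ _ _ this]


lemma HasContinuousLogOn.preimage_symm {D : Set X} (hlD : HasContinuousLogOn D)
    (e : OpenPartialHomeomorph X ℂ) (ht : e.target = Set.univ) (hD : D ⊆ e.source) :
    HasContinuousLogOn (e.symm ⁻¹' D) := by
  intro f hf h0
  have hs : ∀ x ∈ D, e x ∈ e.symm ⁻¹' D := fun x hx ↦ by simpa [e.left_inv (hD hx)] using hx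
  obtain ⟨g, hg, hgf⟩ := hlD (f ∘ e) (hf.comp (e.continuousOn.mono hD) hs) fun x hx ↦ h0 _ (hs x hx)
  have hc : Continuous e.symm := by
    rw [← continuousOn_univ, ← ht]; exact e.continuousOn_symm
  refine ⟨g ∘ e.symm, hg.comp hc.continuousOn fun z hz ↦ hz, fun z hz ↦ ?_⟩
  simp [hgf _ hz, e.right_inv (ht ▸ Set.mem_univ z)]

/-- A closed set with continuous logarithms does not separate a compact space all of whose
one-point complements are planes. -/
lemma HasContinuousLogOn.isPreconnected_compl [CompactSpace X]
    (he : ∀ q : X, ∃ e : OpenPartialHomeomorph X ℂ, e.source = {q}ᶜ ∧ e.target = Set.univ)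
    {D : Set X} (hD : IsClosed D) (hlD : HasContinuousLogOn D) : IsPreconnected Dᶜ := by
  rw [isPreconnected_iff_subset_of_disjoint]
  intro u v hu hv huv hd
  by_contra! hcon
  obtain ⟨⟨q, hq, hqu⟩, ⟨p, hp, hpv⟩⟩ := hcon.imp Set.not_subset.1 Set.not_subset.1
  have hpu := (huv hp).resolve_right hpv
  have hqv := (huv hq).resolve_left hqu
  obtain ⟨e, hes, het⟩ := he q
  have hc : Continuous e.symm := by
    rw [← continuousOn_univ, ← het]; exact e.continuousOn_symm
  have hmem : ∀ x, x ≠ q → x ∈ e.source := fun x hx ↦ by simpa [hes] using hx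
  have hdisj : ∀ x, x ∉ D → x ∈ u → x ∉ v := fun x hxD hxu hxv ↦ by
    have : x ∈ Dᶜ ∩ (u ∩ v) := ⟨hxD, hxu, hxv⟩
    simp [hd] at this
  have hcl : IsClosed (D ∪ u) := by
    have : D ∪ u = (Dᶜ ∩ v)ᶜ := by
      ext x
      have h1 := hdisj x
      have h2 := @huv x
      simp only [Set.mem_union, Set.mem_compl_iff, Set.mem_inter_iff] at *
      tauto
    rw [this]
    exact (hD.isOpen_compl.inter hv).isClosed_compl
  have hW : e.symm ⁻¹' (Dᶜ ∩ u) = ∅ := by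
    refine (hlD.preimage_symm e het fun x hx ↦
      hmem x fun h ↦ hq (h ▸ hx)).eq_empty_of_frontier_subset (hD.preimage hc) ?_ ?_ ?_
    · have hcomp : IsCompact (e '' (Dᶜ ∩ v)ᶜ) :=
        (hD.isOpen_compl.inter hv).isClosed_compl.isCompact.image_of_continuousOn
          (e.continuousOn.mono fun x hx ↦ hmem x fun h ↦ hx (h ▸ ⟨hq, hqv⟩))
      refine hcomp.isBounded.subset fun z hz ↦ ⟨e.symm z, fun h ↦ hdisj _ hz.1 hz.2 h.2, ?_⟩
      exact e.right_inv (het ▸ Set.mem_univ z)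
    · exact Set.disjoint_left.2 fun z hz hz' ↦ hz.1 hz'
    · intro z hz
      rw [((hD.isOpen_compl.inter hu).preimage hc).frontier_eq] at hz
      have h1 : z ∈ e.symm ⁻¹' (D ∪ u) := (hcl.preimage hc).closure_subset_iff.2
        (fun w hw ↦ Or.inr hw.2) hz.1
      by_contra hzD
      exact hz.2 ⟨hzD, h1.resolve_left hzD⟩
  have : e p ∈ e.symm ⁻¹' (Dᶜ ∩ u) := by
    rw [Set.mem_preimage, e.left_inv (hmem p fun h ↦ hqu (h ▸ hpu))]
    exact ⟨hp, hpu⟩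
  simp [hW] at this

lemma HasContinuousLogOn.source (e : OpenPartialHomeomorph X ℂ) (ht : e.target = Set.univ) :
    HasContinuousLogOn e.source :=
  let h := e.toHomeomorphSourceTarget.trans ((Homeomorph.setCongr ht).trans (Homeomorph.Set.univ ℂ))
  .of_retract ⟨h, h.continuous⟩ ⟨h.symm, h.symm.continuous⟩ h.symm_apply_apply

lemma hasContinuousLogOn_univ_of_charts [T1Space X] [Nontrivial X]
    (he : ∀ q : X, ∃ e : OpenPartialHomeomorph X ℂ, e.source = {q}ᶜ ∧ e.target = Set.univ) :
    HasContinuousLogOn (Set.univ : Set X) := by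
  obtain ⟨p, q, hpq⟩ := exists_pair_ne X
  obtain ⟨e, hes, het⟩ := he p
  obtain ⟨e', hes', het'⟩ := he q
  have hc : Continuous e.symm := by
    rw [← continuousOn_univ, ← het]; exact e.continuousOn_symm
  have hq : q ∈ e.source := by simpa [hes] using hpq.symm
  have himg : e.symm '' {e q}ᶜ = {p}ᶜ ∩ {q}ᶜ := by
    ext x
    constructor
    · rintro ⟨z, hz, rfl⟩
      have hzt : z ∈ e.target := het ▸ Set.mem_univ z
      refine ⟨hes ▸ e.map_target hzt, fun h ↦ hz ?_⟩
      rw [Set.mem_singleton_iff] at h ⊢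
      rw [← h, e.right_inv hzt]
    · rintro ⟨hxp, hxq⟩
      rw [← hes] at hxp
      exact ⟨e x, fun h ↦ hxq (e.injOn hxp hq h), e.left_inv hxp⟩
  have hconn : IsConnected ({p}ᶜ ∩ {q}ᶜ : Set X) :=
    himg ▸ (isConnected_compl_singleton_of_one_lt_rank (by simp) _).image _ hc.continuousOn
  have huniv : ({p}ᶜ ∪ {q}ᶜ : Set X) = Set.univ := by
    rw [← Set.compl_inter, Set.singleton_inter_eq_empty.2 (by simpa using hpq), Set.compl_empty]
  exact huniv ▸ HasContinuousLogOn.union isOpen_compl_singleton isOpen_compl_singleton hconn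
    (hes ▸ .source e het) (hes' ▸ .source e' het')

lemma HasContinuousLogOn.of_homeomorph_closedBall {D : Set X}
    (h : D ≃ₜ closedBall (0 : ℂ) 1) : HasContinuousLogOn D := by
  have hr : Continuous fun z : ℂ ↦ ((max 1 ‖z‖)⁻¹ : ℝ) • z := by
    refine ((continuous_const.max continuous_norm).inv₀ fun z ↦ ?_).smul continuous_id
    positivity
  have hm : ∀ z : ℂ, ((max 1 ‖z‖)⁻¹ : ℝ) • z ∈ closedBall (0 : ℂ) 1 := fun z ↦ by
    have h0 : (0 : ℝ) < max 1 ‖z‖ := by positivity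
    rw [mem_closedBall_zero_iff, norm_smul, norm_inv, Real.norm_of_nonneg h0.le, inv_mul_le_iff₀ h0]
    simp
  refine .of_retract ⟨fun x ↦ (h x : ℂ), continuous_subtype_val.comp h.continuous⟩
    ⟨fun z ↦ h.symm ⟨_, hm z⟩, h.symm.continuous.comp (hr.subtype_mk hm)⟩ fun x ↦ ?_
  have : ‖(h x : ℂ)‖ ≤ 1 := mem_closedBall_zero_iff.1 (h x).2
  simp [max_eq_left this]

end ContinuousLog

section Sphere

open Filter Topology

variable {E : Type*} [NormedAddCommGroup E]

lemma dist_le_two_of_unit_sphere (x y : sphere (0 : E) 1) : dist x y ≤ 2 := by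
  have := norm_sub_le (x : E) y
  rw [Subtype.dist_eq, dist_eq_norm]
  simp only [norm_eq_of_mem_sphere] at this
  linarith

lemma diam_le_two_of_unit_sphere (K : Set (sphere (0 : E) 1)) : diam K ≤ 2 :=
  diam_le_of_forall_dist_le zero_le_two fun x _ y _ ↦ dist_le_two_of_unit_sphere x y

lemma IsCompact.exists_dist_eq_diam {Y : Type*} [PseudoMetricSpace Y] {K : Set Y}
    (hK : IsCompact K) (hne : K.Nonempty) : ∃ a ∈ K, ∃ b ∈ K, dist a b = diam K := by
  obtain ⟨⟨a, b⟩, ⟨ha, hb⟩, h⟩ := (hK.prod hK).exists_isMaxOn (hne.prod hne)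
    (f := fun p : Y × Y ↦ dist p.1 p.2) (by fun_prop)
  exact ⟨a, ha, b, hb, (dist_le_diam_of_mem hK.isBounded ha hb).antisymm
    (diam_le_of_forall_dist_le dist_nonneg fun x hx y hy ↦ h (a := (x, y)) ⟨hx, hy⟩)⟩

variable [InnerProductSpace ℝ E]

lemma dist_eq_two_iff_of_unit_sphere {x y : sphere (0 : E) 1} : dist x y = 2 ↔ y = -x := by
  have h := parallelogram_law_with_norm ℝ (x : E) y
  simp only [norm_eq_of_mem_sphere] at h
  rw [Subtype.dist_eq, dist_eq_norm, Subtype.ext_iff, coe_neg_sphere,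
    eq_neg_iff_add_eq_zero, ← norm_eq_zero, add_comm (y : E)]
  have h1 := norm_nonneg ((x : E) + y)
  have h2 := norm_nonneg ((x : E) - y)
  constructor <;> intro h3
  · rw [h3] at h; nlinarith
  · rw [h3] at h; nlinarith

/-- A point of the unit sphere can be pushed away from any point that is neither equal nor antipodal
to it. -/
lemma exists_mem_dist_lt_of_unit_sphere {a b : sphere (0 : E) 1} (hab : b ≠ a) (hab' : b ≠ -a)
    {N : Set (sphere (0 : E) 1)} (hN : N ∈ 𝓝 a) : ∃ c ∈ N, dist a b < dist c b := by
  obtain ⟨ε, hε, hεN⟩ := Metric.mem_nhds_iff.1 hN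
  have hna : ‖(a : E)‖ = 1 := norm_eq_of_mem_sphere a
  have hnb : ‖(b : E)‖ = 1 := norm_eq_of_mem_sphere b
  have hs1 : inner ℝ (a : E) b < 1 := lt_of_le_of_ne
    (by simpa [hna, hnb] using real_inner_le_norm (a : E) b)
    fun h ↦ hab (Subtype.ext ((inner_eq_one_iff_of_norm_eq_one hna hnb).1 h).symm)
  have hs2 : -1 < inner ℝ (a : E) b := by
    have hle := neg_le_of_abs_le (abs_real_inner_le_norm (a : E) b)
    rw [hna, hnb, one_mul] at hle
    refine hle.lt_of_ne fun h ↦ hab' (Subtype.ext ?_)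
    have := (inner_eq_one_iff_of_norm_eq_one (𝕜 := ℝ) (x := -(a : E)) (by simp) hnb).1
      (by rw [inner_neg_left, ← h, neg_neg])
    simpa using this.symm
  have hcont : ContinuousAt
      (fun t : ℝ ↦ ‖(a : E) - t • (b : E)‖⁻¹ • ((a : E) - t • (b : E))) 0 :=
    .smul (.inv₀ (by fun_prop) (by simp [hna])) (by fun_prop)
  have hev : ∀ᶠ t : ℝ in 𝓝[>] 0,
      ‖(a : E) - t • (b : E)‖⁻¹ • ((a : E) - t • (b : E)) ∈ ball (a : E) ε :=
    (hcont.mono_left nhdsWithin_le_nhds) (by simpa [hna] using ball_mem_nhds (a : E) hε)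
  obtain ⟨t, ht, ht0, ht1⟩ := (hev.and (Ioo_mem_nhdsGT (zero_lt_one' ℝ))).exists
  set s := inner ℝ (a : E) b with hs
  set n := ‖(a : E) - t • (b : E)‖ with hn
  have hn2 : n ^ 2 = 1 - 2 * t * s + t ^ 2 := by
    rw [hn, norm_sub_sq_real, norm_smul, inner_smul_right, hna, hnb, Real.norm_of_nonneg ht0.le]
    ring
  have hn0 : 0 < n := by
    refine lt_of_le_of_ne (norm_nonneg _) fun h ↦ ?_
    rw [← h] at hn2
    nlinarith [mul_pos ht0 (sub_pos.2 hs1), sq_nonneg (1 - t)]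
  have hc : n⁻¹ • ((a : E) - t • (b : E)) ∈ sphere (0 : E) 1 := by
    rw [mem_sphere_zero_iff_norm, norm_smul, norm_inv, Real.norm_of_nonneg hn0.le, ← hn,
      inv_mul_cancel₀ hn0.ne']
  refine ⟨⟨_, hc⟩, hεN ht, ?_⟩
  have hinner : inner ℝ (n⁻¹ • ((a : E) - t • (b : E))) (b : E) = n⁻¹ * (s - t) := by
    rw [real_inner_smul_left, inner_sub_left, real_inner_smul_left, real_inner_self_eq_norm_sq, hnb]
    ring
  have hlt : n⁻¹ * (s - t) < s := by
    rw [inv_mul_lt_iff₀ hn0]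
    rcases le_or_gt 0 s with h | h
    · have h1 : 1 - t * s ≤ n := by
        refine (abs_le_of_sq_le_sq' ?_ hn0.le).2
        have h2 : s ^ 2 ≤ 1 := by nlinarith
        nlinarith [mul_le_mul_of_nonneg_left h2 (sq_nonneg t)]
      nlinarith [mul_pos ht0 (sub_pos.2 hs1)]
    · have h1 : n < 1 + t := by
        refine lt_of_pow_lt_pow_left₀ 2 (by positivity) ?_
        nlinarith
      nlinarith
  rw [Subtype.dist_eq, Subtype.dist_eq, dist_eq_norm, dist_eq_norm]
  refine lt_of_pow_lt_pow_left₀ 2 (norm_nonneg _) ?_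
  rw [norm_sub_sq_real, norm_sub_sq_real, hinner, mem_sphere_zero_iff_norm.1 hc, hna, hnb]
  linarith

lemma diam_le_diam_frontier_of_lt_two [CompactSpace (sphere (0 : E) 1)]
    {K : Set (sphere (0 : E) 1)} (hK : IsClosed K) (hd : diam K < 2) :
    diam K ≤ diam (frontier K) := by
  have hb : ∀ S : Set (sphere (0 : E) 1), Bornology.IsBounded S := fun S ↦
    isBounded_iff.2 ⟨2, fun x _ y _ ↦ dist_le_two_of_unit_sphere x y⟩
  rcases K.eq_empty_or_nonempty with rfl | hne
  · simp
  obtain ⟨a, ha, b, hbK, hab⟩ := hK.isCompact.exists_dist_eq_diam hne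
  rcases eq_or_ne a b with rfl | hne'
  · rw [← hab, dist_self]; exact diam_nonneg
  have key : ∀ x ∈ K, ∀ y ∈ K, x ≠ y → dist x y = diam K → x ∈ frontier K := by
    intro x hx y hy hxy h
    rw [hK.frontier_eq]
    refine ⟨hx, fun hi ↦ ?_⟩
    obtain ⟨c, hc, hlt⟩ := exists_mem_dist_lt_of_unit_sphere hxy.symm
      (fun h' ↦ hd.ne (h ▸ dist_eq_two_iff_of_unit_sphere.2 h')) (mem_interior_iff_mem_nhds.1 hi)
    exact (hlt.trans_le (dist_le_diam_of_mem (hb K) hc hy)).ne h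
  rw [← hab]
  exact dist_le_diam_of_mem (hb _) (key a ha b hbK hne' hab)
    (key b hbK a ha hne'.symm (dist_comm a b ▸ hab))

/-- If two closed connected sets with connected nonempty intersection cover a space and each of them
meets its image under an involution, then so does their intersection. -/
lemma exists_mem_inter_of_involutive {Y : Type*} [TopologicalSpace Y]
    {ι : Y → Y} (hιc : Continuous ι) (hι : Function.Involutive ι) {A B : Set Y}
    (hA : IsClosed A) (hB : IsClosed B) (hAc : IsPreconnected A) (hBc : IsPreconnected B)
    (hAB : A ∪ B = Set.univ) (hc : IsPreconnected (A ∩ B)) (hne : (A ∩ B).Nonempty)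
    (ha : ∃ a ∈ A, ι a ∈ A) (hb : ∃ b ∈ B, ι b ∈ B) : ∃ x ∈ A ∩ B, ι x ∈ A ∩ B := by
  by_contra! hcon
  have hcov : ∀ x, x ∈ A ∨ x ∈ B := fun x ↦ (hAB ▸ Set.mem_univ x : x ∈ A ∪ B)
  have key : ∀ A B : Set Y, IsClosed A → IsClosed B → IsPreconnected A → (∀ x, x ∈ A ∨ x ∈ B) →
      (A ∩ B).Nonempty → (∃ a ∈ A, ι a ∈ A) → (∀ x ∈ A ∩ B, ι x ∈ Aᶜ) → False := by
    rintro A B hA hB hAc hcov ⟨z, hzA, hzB⟩ ⟨a, haA, ha⟩ h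
    rcases hAc.subset_or_subset (u := ι ⁻¹' Bᶜ) (v := ι ⁻¹' Aᶜ) (hB.isOpen_compl.preimage hιc)
      (hA.isOpen_compl.preimage hιc)
      (Set.disjoint_left.2 fun x hx hx' ↦ (hcov (ι x)).elim hx' hx)
      (fun x hx ↦ by
        by_contra hcon
        simp only [Set.mem_union, Set.mem_preimage, Set.mem_compl_iff, not_or, not_not] at hcon
        exact h (ι x) ⟨hcon.2, hcon.1⟩ (by rwa [hι x])) with h' | h'
    · have hAB : ∀ x ∈ A, x ∈ Bᶜ := fun x hx hxB ↦ by
        have h1 : ι x ∈ A := (hcov _).resolve_right (h' hx)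
        exact h' h1 (by rwa [hι x])
      exact hAB z hzA hzB
    · exact h' haA ha
  rcases hc.subset_or_subset (u := ι ⁻¹' Aᶜ) (v := ι ⁻¹' Bᶜ) (hA.isOpen_compl.preimage hιc)
      (hB.isOpen_compl.preimage hιc)
      (Set.disjoint_left.2 fun x hx hx' ↦ (hcov (ι x)).elim hx hx')
      (fun x hx ↦ by
        have := hcon x hx
        simp only [Set.mem_union, Set.mem_preimage, Set.mem_compl_iff, Set.mem_inter_iff] at *
        tauto) with h | h
  · exact key A B hA hB hAc hcov hne ha h
  · exact key B A hB hA hBc (fun x ↦ (hcov x).symm) (Set.inter_comm A B ▸ hne) hb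
      (fun x hx ↦ h (Set.inter_comm A B ▸ hx))

lemma exists_sphere_chart (q : sphere (0 : EuclideanSpace ℝ (Fin 3)) 1) :
    ∃ e : OpenPartialHomeomorph (sphere (0 : EuclideanSpace ℝ (Fin 3)) 1) ℂ,
      e.source = {q}ᶜ ∧ e.target = Set.univ := by
  have : Fact (Module.finrank ℝ (EuclideanSpace ℝ (Fin 3)) = 2 + 1) := ⟨by simp⟩
  refine ⟨(stereographic' 2 q).transHomeomorph
    Complex.orthonormalBasisOneI.repr.symm.toHomeomorph, ?_, ?_⟩ <;> simp

end Sphere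

/-- For a closed Jordan region `D` in the chordal Riemann sphere (the unit sphere in `ℝ³`),
either `diam D = diam ∂D`, or `diam D = 2` and the complementary closed Jordan region
`univ \ int D` has diameter equal to `diam ∂D`. -/
theorem diam_jordanRegion_sphere
    (D : Set ↥(sphere (0 : EuclideanSpace ℝ (Fin 3)) 1))
    (hD : Nonempty (↥D ≃ₜ ↥(closedBall (0 : ℂ) 1))) :
    diam D = diam (frontier D) ∨
      (diam D = 2 ∧ diam (Set.univ \ interior D) = diam (frontier D)) := by
  obtain ⟨h⟩ := hD
  have hconn : PreconnectedSpace (sphere (0 : EuclideanSpace ℝ (Fin 3)) 1) :=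
    Subtype.preconnectedSpace (isPreconnected_sphere (by simp [← Module.finrank_eq_rank]) _ _)
  have hbdd : ∀ S : Set (sphere (0 : EuclideanSpace ℝ (Fin 3)) 1), Bornology.IsBounded S :=
    fun S ↦ isBounded_of_compactSpace
  have hcompD : CompactSpace D := h.symm.compactSpace
  have hDcl : IsClosed D := (isCompact_iff_compactSpace.2 hcompD).isClosed
  have hDconn : IsConnected D := by
    have : ConnectedSpace (closedBall (0 : ℂ) 1) := Subtype.connectedSpace
      ((convex_closedBall _ _).isConnected ⟨0, by simp⟩)
    exact isConnected_iff_connectedSpace.2 (h.symm.surjective.connectedSpace h.symm.continuous)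
  rw [← Set.compl_eq_univ_sdiff]
  have hEcl : IsClosed (interior D)ᶜ := isOpen_interior.isClosed_compl
  have hcap : D ∩ (interior D)ᶜ = frontier D := hDcl.frontier_eq.symm
  have hfrE : frontier (interior D)ᶜ ⊆ frontier D := by
    rw [frontier_compl]; exact frontier_interior_subset
  have hdiam : ∀ K : Set (sphere (0 : EuclideanSpace ℝ (Fin 3)) 1), IsClosed K →
      frontier K ⊆ frontier D → frontier D ⊆ K → diam K ≠ 2 → diam K = diam (frontier D) :=
    fun K hK h1 h2 h3 ↦ ((diam_le_diam_frontier_of_lt_two hK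
      ((diam_le_two_of_unit_sphere K).lt_of_ne h3)).trans (diam_mono h1 (hbdd _))).antisymm
      (diam_mono h2 (hbdd _))
  by_cases hD2 : diam D = 2
  swap
  · exact .inl (hdiam D hDcl subset_rfl hDcl.frontier_subset hD2)
  by_cases hE2 : diam (interior D)ᶜ = 2
  swap
  · exact .inr ⟨hD2, hdiam _ hEcl hfrE (hcap ▸ Set.inter_subset_right) hE2⟩
  left
  have hpair : ∀ K : Set (sphere (0 : EuclideanSpace ℝ (Fin 3)) 1), IsClosed K → diam K = 2 →
      ∃ a ∈ K, -a ∈ K := fun K hK hK2 ↦ by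
    have hne : K.Nonempty := Set.nonempty_iff_ne_empty.2 fun h ↦ by simp [h] at hK2
    obtain ⟨a, ha, b, hb, hab⟩ := hK.isCompact.exists_dist_eq_diam hne
    exact ⟨a, ha, dist_eq_two_iff_of_unit_sphere.1 (hab.trans hK2) ▸ hb⟩
  obtain ⟨c, hc, hc'⟩ := hpair _ hEcl hE2
  have hfrne : (frontier D).Nonempty := by
    refine Set.nonempty_iff_ne_empty.2 fun h0 ↦ ?_
    rcases frontier_eq_empty_iff.1 h0 with h0 | h0
    · exact hDconn.nonempty.ne_empty h0
    · simp [h0] at hc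
  have hEconn : IsPreconnected (interior D)ᶜ := by
    rw [← closure_compl]
    exact ((HasContinuousLogOn.of_homeomorph_closedBall h).isPreconnected_compl
      exists_sphere_chart hDcl).closure
  have hcover : D ∪ (interior D)ᶜ = Set.univ :=
    Set.eq_univ_of_forall fun x ↦ (em (x ∈ interior D)).imp (interior_subset ·) id
  have hnt : Nontrivial (sphere (0 : EuclideanSpace ℝ (Fin 3)) 1) :=
    ⟨c, -c, fun h ↦ by
      have := dist_eq_two_iff_of_unit_sphere.2 (rfl : -c = -c)
      rw [← h, dist_self] at this
      norm_num at this⟩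
  obtain ⟨x, hx, hx'⟩ := exists_mem_inter_of_involutive continuous_neg neg_involutive hDcl hEcl
    hDconn.isPreconnected hEconn hcover (hDconn.isPreconnected.inter_of_union_eq_univ
      (hasContinuousLogOn_univ_of_charts exists_sphere_chart) hDcl hEcl hEconn hcover)
    (hcap ▸ hfrne) (hpair D hDcl hD2) ⟨c, hc, hc'⟩
  rw [hcap] at hx hx'
  refine le_antisymm ?_ (diam_mono hDcl.frontier_subset (hbdd _))
  rw [hD2, ← dist_eq_two_iff_of_unit_sphere.2 (rfl : -x = -x)]
  exact dist_le_diam_of_mem (hbdd _) hx hx'
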